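/- Under the setup, suppose at least one nontrivial component H of G*[U] satisfies γ(H) > 0. Then every vertex w ∈ W_0 (i.e., w ∈ W with no neighbor in W) satisfies x_w ≤ ((2λ−3)/(2λ))·x_{u*}. -/

import Mathlib

open SimpleGraph Finset
open scoped Classical

/-- The spectral radius of a finite simple graph: the largest eigenvalue of its
adjacency matrix (expressed as the supremum of the set of eigenvalues). -/
noncomputable def specRad {V : Type*} [Fintype V] (G : SimpleGraph V) : ℝ :=
  sSup {t : ℝ | Module.End.HasEigenvalue (Matrix.toLin' (G.adjMatrix ℝ)) t}

/-- The fan graph `F₆ = K₁ ∨ P₅`: the path `0-1-2-3-4` together with the hub `5`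
adjacent to all of `0,…,4`. -/
def fan6 : SimpleGraph (Fin 6) :=
  SimpleGraph.fromRel (fun a b => b = 5 ∨ (b.val = a.val + 1 ∧ b.val ≤ 4))

/-- A graph is `F₆`-free if it contains no subgraph isomorphic to the fan `F₆`,
i.e. there is no injective graph homomorphism from `F₆` into it. -/
def F6Free {V : Type*} (G : SimpleGraph V) : Prop :=
  ¬ ∃ f : fan6 →g G, Function.Injective f

/-- The join `K₂ ∨ kK₁`: two adjacent vertices, each adjacent to `k` further
pairwise non-adjacent vertices. -/
def K2JoinEmpty (k : ℕ) : SimpleGraph (Fin 2 ⊕ Fin k) :=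
  SimpleGraph.fromRel (fun a b => a.isLeft ∨ b.isLeft)

/-- `dS G S v` is the number of neighbors of `v` lying in `S`. -/
noncomputable def dS {V : Type*} (G : SimpleGraph V) (S : Set V) (v : V) : ℕ :=
  (G.neighborSet v ∩ S).ncard

/-- `eIn G S` is the number of edges of the induced subgraph `G[S]`. -/
noncomputable def eIn {V : Type*} (G : SimpleGraph V) (S : Set V) : ℕ :=
  {e ∈ G.edgeSet | ∀ v ∈ e, v ∈ S}.ncard

/-- `eBetween G S T` is the number of edges with one endpoint in `S` and the
other in `T`. -/
noncomputable def eBetween {V : Type*} (G : SimpleGraph V) (S T : Set V) : ℕ :=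
  {e ∈ G.edgeSet | ∃ a ∈ S, ∃ b ∈ T, e = s(a, b)}.ncard

/-- `gamma G x ustar S = Σ_{u∈S} (d_S(u) - 1)·x_u/x_{u*} - e(S)`. -/
noncomputable def gamma {V : Type*} [Fintype V] (G : SimpleGraph V) (x : V → ℝ)
    (ustar : V) (S : Set V) : ℝ :=
  (∑ u ∈ S.toFinset, ((dS G S u : ℝ) - 1) * (x u / x ustar)) - eIn G S

/-- The star `K_{1,r}` with center `0` and `r` leaves. -/
def starGraph (r : ℕ) : SimpleGraph (Fin (r + 1)) :=
  SimpleGraph.fromRel (fun a _ => a = 0)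

/-- `K_{1,r} + e`: the star with center `0` and `r` leaves, plus an edge joining
the two leaves `1` and `2`. -/
def starPlusEdge (r : ℕ) : SimpleGraph (Fin (r + 1)) :=
  SimpleGraph.fromRel (fun a b => a = 0 ∨ (a = 1 ∧ b = 2))

/-- The double star `D_{a,b}`: centers `0` and `1` joined by an edge, `0` joined
to the `a` leaves `2,…,a+1`, and `1` joined to the `b` leaves `a+2,…,a+b+1`. -/
def doubleStar (a b : ℕ) : SimpleGraph (Fin (a + b + 2)) :=
  SimpleGraph.fromRel (fun u v =>
    (u.val = 0 ∧ v.val = 1) ∨ (u.val = 0 ∧ 2 ≤ v.val ∧ v.val < a + 2) ∨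
      (u.val = 1 ∧ a + 2 ≤ v.val))

/-- `K₄ - e`: the complete graph on 4 vertices minus the edge `{0,1}`. -/
def K4MinusE : SimpleGraph (Fin 4) :=
  SimpleGraph.fromRel (fun u v => ¬(u = 0 ∧ v = 1) ∧ ¬(u = 1 ∧ v = 0))

lemma F6Free.no_fan {V : Type*} {G : SimpleGraph V} (hfree : F6Free G)
    {h p q r s t : V} (hnd : [p, q, r, s, t].Nodup)
    (hpq : G.Adj p q) (hqr : G.Adj q r) (hrs : G.Adj r s) (hst : G.Adj s t)
    (hp : G.Adj h p) (hq : G.Adj h q) (hr : G.Adj h r) (hs : G.Adj h s) (ht : G.Adj h t) :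
    False := by
  refine hfree ⟨⟨![p, q, r, s, t, h], ?_⟩, ?_⟩
  · intro a b hab
    rw [fan6, SimpleGraph.fromRel_adj] at hab
    fin_cases a <;> fin_cases b <;>
      first
      | (exfalso; revert hab; decide)
      | (simp only [Fin.reduceFinMk]; first | assumption | (apply SimpleGraph.Adj.symm; assumption))
  · have := hp.ne; have := hq.ne; have := hr.ne; have := hs.ne; have := ht.ne
    have hnd' : (List.ofFn ![p, q, r, s, t, h]).Nodup := by
      simp at hnd ⊢
      grind
    exact List.nodup_ofFn.1 hnd'

/-- A graph with no (not necessarily induced) path on five vertices. -/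
def P5Free {α : Type*} (H : SimpleGraph α) : Prop :=
  ∀ p q r s t : α, [p, q, r, s, t].Nodup →
    H.Adj p q → H.Adj q r → H.Adj r s → H.Adj s t → False

lemma SimpleGraph.Connected.forall_of_adj_closed {α : Type*} {H : SimpleGraph α}
    (hconn : H.Connected) {P : α → Prop} {a : α} (ha : P a)
    (hP : ∀ u v, H.Adj u v → P u → P v) (v : α) : P v := by
  obtain ⟨p⟩ := hconn.preconnected a v
  induction p with
  | nil => exact ha
  | cons h _ ih => exact ih (hP _ _ h ha)

lemma P5Free.eq_of_four_cycle {α : Type*} {H : SimpleGraph α} (hfree : P5Free H)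
    (hconn : H.Connected) {a b c d : α} (hab : H.Adj a b) (hbc : H.Adj b c) (hcd : H.Adj c d)
    (hda : H.Adj d a) (hac : a ≠ c) (hbd : b ≠ d) (v : α) :
    v = a ∨ v = b ∨ v = c ∨ v = d := by
  refine hconn.forall_of_adj_closed (P := fun v => v = a ∨ v = b ∨ v = c ∨ v = d)
    (a := a) (Or.inl rfl) (fun u v huv hu => ?_) v
  by_contra hv
  have h1 := hab.ne
  have h2 := hbc.ne
  have h3 := hcd.ne
  have h4 := hda.ne
  rcases hu with rfl | rfl | rfl | rfl
  · exact hfree v _ b c d (by simp; grind) huv.symm hab hbc hcd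
  · exact hfree v _ c d a (by simp; grind) huv.symm hbc hcd hda
  · exact hfree v _ d a b (by simp; grind) huv.symm hcd hda hab
  · exact hfree v _ a b c (by simp; grind) huv.symm hda hab hbc

lemma P5Free.card_edgeFinset_le_of_triangle {α : Type*} [Fintype α] {H : SimpleGraph α}
    (hfree : P5Free H) (hconn : H.Connected)
    (hC4 : ∀ a b c d, H.Adj a b → H.Adj b c → H.Adj c d → H.Adj d a → a ≠ c → b ≠ d → False)
    {a b c : α} (hab : H.Adj a b) (hbc : H.Adj b c) (hca : H.Adj c a) :
    H.edgeFinset.card ≤ Fintype.card α := by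
  have h1 := hab.ne
  have h2 := hbc.ne
  have h3 := hca.ne
  have hdom : ∀ v, v ∈ ({a, b, c} : Finset α) ∨ H.Adj v a ∨ H.Adj v b ∨ H.Adj v c := by
    refine hconn.forall_of_adj_closed (a := a) (by simp) (fun u v huv hu => ?_)
    by_contra hv
    simp only [Finset.mem_insert, Finset.mem_singleton] at hu hv
    have h4 := huv.ne
    have hu' : ¬ (u = a ∨ u = b ∨ u = c) := by
      rintro (rfl | rfl | rfl) <;> simp [huv.symm] at hv
    rcases hu with hu | hu | hu | hu
    · exact hu' hu
    · exact hfree v u a b c (by simp; grind) huv.symm hu hab hbc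
    · exact hfree v u b c a (by simp; grind) huv.symm hu hbc hca
    · exact hfree v u c a b (by simp; grind) huv.symm hu hca hab
  have hnb : ∀ v, v ∉ ({a, b, c} : Finset α) → ∃ t, ∀ u, H.Adj v u → u = t := by
    intro v hv
    have key : ∀ a b c : α, H.Adj a b → H.Adj b c → H.Adj c a →
        ¬ (v = a ∨ v = b ∨ v = c) → H.Adj v a → ∀ u, H.Adj v u → u = a := by
      intro a b c hab hbc hca hv hva u hvu
      by_contra hua
      have h1 := hab.ne
      have h2 := hbc.ne
      have h3 := hca.ne
      have h4 := hvu.ne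
      by_cases hub : u = b
      · subst hub
        exact hC4 v u c a hvu hbc hca hva.symm (by grind) hua
      by_cases huc : u = c
      · subst huc
        exact hC4 v u b a hvu hbc.symm hab.symm hva.symm (by grind) hua
      exact hfree u v a b c (by simp; grind) hvu.symm hva hab hbc
    have hv' : ¬ (v = a ∨ v = b ∨ v = c) := by simpa using hv
    rcases hdom v with h | h | h | h
    · exact absurd h hv
    · exact ⟨a, key a b c hab hbc hca hv' h⟩
    · exact ⟨b, key b c a hbc hca hab (by tauto) h⟩
    · exact ⟨c, key c a b hca hab hbc (by tauto) h⟩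
  choose! f hf using hnb
  have hsub : H.edgeFinset ⊆
      ({s(a, b), s(b, c), s(c, a)} : Finset (Sym2 α)) ∪
        ({a, b, c} : Finset α)ᶜ.image (fun v => s(v, f v)) := by
    intro e
    induction e with
    | _ u v =>
    intro he
    have huv : H.Adj u v := by simpa using he
    rw [Finset.mem_union, Finset.mem_image]
    by_cases hu : u ∈ ({a, b, c} : Finset α)
    · by_cases hv : v ∈ ({a, b, c} : Finset α)
      · left
        have := huv.ne
        simp only [Finset.mem_insert, Finset.mem_singleton] at hu hv
        rcases hu with rfl | rfl | rfl <;> rcases hv with rfl | rfl | rfl <;>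
          first
          | exact absurd rfl this
          | simp
      · right
        exact ⟨v, by simpa using hv, by rw [← hf v hv u huv.symm, Sym2.eq_swap]⟩
    · right
      exact ⟨u, by simpa using hu, by rw [← hf u hu v huv]⟩
  have hcard3 : ({a, b, c} : Finset α).card = 3 :=
    Finset.card_eq_three.2 ⟨a, b, c, h1, h3.symm, h2, rfl⟩
  have hadd := Finset.card_add_card_compl ({a, b, c} : Finset α)
  have hE3 : ({s(a, b), s(b, c), s(c, a)} : Finset (Sym2 α)).card ≤ 3 := Finset.card_le_three
  have hle := (Finset.card_le_card hsub).trans (Finset.card_union_le _ _)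
  have himg := Finset.card_image_le (s := ({a, b, c} : Finset α)ᶜ) (f := fun v => s(v, f v))
  omega

lemma P5Free.exists_four_cycle {α : Type*} [Fintype α] {H : SimpleGraph α}
    (hfree : P5Free H) (hconn : H.Connected) (hcard : Fintype.card α < H.edgeFinset.card) :
    ∃ a b c d, H.Adj a b ∧ H.Adj b c ∧ H.Adj c d ∧ H.Adj d a ∧ a ≠ c ∧ b ≠ d := by
  by_contra hno
  have hC4 : ∀ a b c d, H.Adj a b → H.Adj b c → H.Adj c d → H.Adj d a →
      a ≠ c → b ≠ d → False :=
    fun a b c d h1 h2 h3 h4 h5 h6 => hno ⟨a, b, c, d, h1, h2, h3, h4, h5, h6⟩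
  by_cases hac : H.IsAcyclic
  · have := (IsTree.mk hconn hac).card_edgeFinset
    omega
  obtain ⟨v, p, hp⟩ : ∃ v, ∃ p : H.Walk v v, p.IsCycle := by
    simpa [SimpleGraph.IsAcyclic] using hac
  have h3 := hp.three_le_length
  have hadj : ∀ i, i < p.length → H.Adj (p.getVert i) (p.getVert (i + 1)) :=
    fun i hi => p.adj_getVert_succ hi
  have hinj : ∀ i j, i < p.length → j < p.length → i ≠ j → p.getVert i ≠ p.getVert j :=
    fun i j hi hj hij h => hij (hp.getVert_injOn' (by simp; omega) (by simp; omega) h)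
  have hlast : p.getVert p.length = p.getVert 0 := by simp
  rcases (by omega : p.length = 3 ∨ p.length = 4 ∨ 5 ≤ p.length) with h | h | h
  · have h20 := hadj 2 (by omega)
    rw [show 2 + 1 = p.length by omega, hlast] at h20
    have := hfree.card_edgeFinset_le_of_triangle hconn hC4 (hadj 0 (by omega))
      (hadj 1 (by omega)) h20
    omega
  · have h30 := hadj 3 (by omega)
    rw [show 3 + 1 = p.length by omega, hlast] at h30
    exact hC4 _ _ _ _ (hadj 0 (by omega)) (hadj 1 (by omega)) (hadj 2 (by omega)) h30
      (hinj _ _ (by omega) (by omega) (by omega)) (hinj _ _ (by omega) (by omega) (by omega))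
  · refine hfree _ _ _ _ _ ?_ (hadj 0 (by omega)) (hadj 1 (by omega)) (hadj 2 (by omega))
      (hadj 3 (by omega))
    have := fun i j (hi : i < 5) (hj : j < 5) => hinj i j (by omega) (by omega)
    simp only [List.nodup_cons, List.mem_cons, List.not_mem_nil, not_or]
    refine ⟨⟨?_, ?_, ?_, ?_, ?_⟩, ⟨?_, ?_, ?_, ?_⟩, ⟨?_, ?_, ?_⟩, ⟨?_, ?_⟩, ?_, ?_⟩ <;>
      first
      | (apply this <;> omega)
      | simp

lemma gamma_range_embedding {α V : Type*} [Fintype α] [Fintype V] {K : SimpleGraph α}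
    {G : SimpleGraph V} (j : K ↪g G) (x : V → ℝ) (ustar : V) :
    gamma G x ustar (Set.range j) =
      ∑ k, ((K.degree k : ℝ) - 1) * (x (j k) / x ustar) - K.edgeFinset.card := by
  have hdeg : ∀ k, dS G (Set.range j) (j k) = K.degree k := by
    intro k
    have : G.neighborSet (j k) ∩ Set.range j = j '' K.neighborSet k := by
      ext v
      constructor
      · rintro ⟨hv, l, rfl⟩
        exact ⟨l, by simpa using hv, rfl⟩
      · rintro ⟨l, hl, rfl⟩
        exact ⟨by simpa using hl, l, rfl⟩
    rw [dS, this, Set.ncard_image_of_injective _ j.injective, Set.ncard_eq_toFinset_card']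
    rfl
  have hedge : eIn G (Set.range j) = K.edgeFinset.card := by
    have : {e ∈ G.edgeSet | ∀ v ∈ e, v ∈ Set.range j} = Sym2.map j '' K.edgeSet := by
      ext e
      constructor
      · induction e with
        | _ u v =>
        rintro ⟨he, hv⟩
        obtain ⟨k, rfl⟩ := hv u (by simp)
        obtain ⟨l, rfl⟩ := hv v (by simp)
        exact ⟨s(k, l), by simpa using he, by simp⟩
      · rintro ⟨e, he, rfl⟩
        induction e with
        | _ k l =>
        exact ⟨by simpa using he, by simp⟩
    rw [eIn, this, Set.ncard_image_of_injective _ (Sym2.map.injective j.injective),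
      Set.ncard_eq_toFinset_card']
    congr
  have hS : ∀ _ : Fintype (Set.range j), (Set.range j).toFinset = Finset.univ.image j := by
    intro
    ext
    simp
  rw [gamma, hedge, hS, Finset.sum_image (fun _ _ _ _ h => j.injective h)]
  simp only [hdeg]

/-- If `N(w) ⊆ N(u)`, the entries of `x` over neighbors of `u` missed by `w` add up to at most
`lam * (x u - x w)`. -/
lemma sum_le_eigenvalue_mul_sub {V : Type*} [Fintype V] {G : SimpleGraph V} [DecidableRel G.Adj]
    {lam : ℝ} {x : V → ℝ} (hxpos : ∀ v, 0 < x v)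
    (heig : (G.adjMatrix ℝ).mulVec x = lam • x) {u w : V}
    (hw : G.neighborFinset w ⊆ G.neighborFinset u) {T : Finset V}
    (hT : ∀ v ∈ T, G.Adj u v ∧ ¬ G.Adj w v) :
    ∑ v ∈ T, x v ≤ lam * (x u - x w) := by
  have hsum : ∀ v, ∑ y ∈ G.neighborFinset v, x y = lam * x v := fun v => by
    have := congrFun heig v
    rwa [SimpleGraph.adjMatrix_mulVec_apply] at this
  have hsub : G.neighborFinset w ∪ T ⊆ G.neighborFinset u :=
    Finset.union_subset hw fun v hv => by simpa using (hT v hv).1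
  have hdisj : Disjoint (G.neighborFinset w) T :=
    Finset.disjoint_left.2 fun v hv hvT => (hT v hvT).2 (by simpa using hv)
  have := Finset.sum_le_sum_of_subset_of_nonneg hsub fun v _ _ => (hxpos v).le
  rw [Finset.sum_union hdisj, hsum, hsum] at this
  linarith

lemma F6Free.not_adj_of_wheel {V : Type*} {G : SimpleGraph V} (hfree : F6Free G)
    {u w a b c d : V} (ha : G.Adj u a) (hb : G.Adj u b) (hc : G.Adj u c) (hd : G.Adj u d)
    (hab : G.Adj a b) (hac : G.Adj a c) (had : G.Adj a d) (hbc : G.Adj b c) (hcd : G.Adj c d)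
    (hbd : b ≠ d) (hwu : w ≠ u) (hwn : ¬ G.Adj u w) (hwa : G.Adj w a) :
    ¬ G.Adj w b ∧ ¬ G.Adj w c ∧ ¬ G.Adj w d := by
  have := hb.ne
  have := hc.ne
  have := hd.ne
  have := hbc.ne
  have := hcd.ne
  have hwb : w ≠ b := fun h => hwn (h ▸ hb)
  have hwc : w ≠ c := fun h => hwn (h ▸ hc)
  have hwd : w ≠ d := fun h => hwn (h ▸ hd)
  refine ⟨fun h => ?_, fun h => ?_, fun h => ?_⟩
  · exact hfree.no_fan (h := a) (p := w) (q := b) (r := c) (s := d) (t := u)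
      (by simp; grind) h hbc hcd hd.symm hwa.symm hab hac had ha.symm
  · exact hfree.no_fan (h := a) (p := w) (q := c) (r := b) (s := u) (t := d)
      (by simp; grind) h hbc.symm hb.symm hd hwa.symm hac hab ha.symm had
  · exact hfree.no_fan (h := a) (p := w) (q := d) (r := c) (s := b) (t := u)
      (by simp; grind) h hcd.symm hbc.symm hb.symm hwa.symm had hac hab ha.symm

/-- If `a, b, c, d` form a `K₄ - e` or `K₄` in the neighborhood of `u`, with `a` and `c` of
degree three, then a large part of the weight of `a, b, c, d` is missed by `w`. -/
lemma F6Free.three_halves_le_of_diamond {V : Type*} [Fintype V] {G : SimpleGraph V}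
    [DecidableRel G.Adj] (hfree : F6Free G) {lam : ℝ} {x : V → ℝ} (hxpos : ∀ v, 0 < x v)
    (heig : (G.adjMatrix ℝ).mulVec x = lam • x) {u w : V} (hmax : ∀ v, x v ≤ x u)
    (hw : G.neighborFinset w ⊆ G.neighborFinset u) (hwu : w ≠ u) (hwn : ¬ G.Adj u w)
    {a b c d : V} (ha : G.Adj u a) (hb : G.Adj u b) (hc : G.Adj u c) (hd : G.Adj u d)
    (hab : G.Adj a b) (hac : G.Adj a c) (had : G.Adj a d) (hbc : G.Adj b c) (hcd : G.Adj c d)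
    (hbd : b ≠ d)
    (hweight : 5 * x u < 2 * x a + x b + 2 * x c + x d ∨
      G.Adj b d ∧ 3 * x u < x a + x b + x c + x d) :
    3 / 2 * x u ≤ lam * (x u - x w) := by
  have hxa := hmax a
  have hxb := hmax b
  have hxc := hmax c
  have hxd := hmax d
  have := hxpos u
  have := hab.ne
  have := hac.ne
  have := had.ne
  have := hbc.ne
  have := hcd.ne
  by_cases hwa : G.Adj w a
  · obtain ⟨nb, nc, nd⟩ :=
      hfree.not_adj_of_wheel ha hb hc hd hab hac had hbc hcd hbd hwu hwn hwa
    have := sum_le_eigenvalue_mul_sub hxpos heig hw (T := {b, c, d}) (by simp [*])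
    rw [Finset.sum_insert (by simp [*]), Finset.sum_pair (by simp [*])] at this
    rcases hweight with h | ⟨-, h⟩ <;> linarith
  by_cases hwc : G.Adj w c
  · obtain ⟨nb, na, nd⟩ :=
      hfree.not_adj_of_wheel hc hb ha hd hbc.symm hac.symm hcd hab.symm had hbd hwu hwn hwc
    have := sum_le_eigenvalue_mul_sub hxpos heig hw (T := {b, a, d}) (by simp [*])
    rw [Finset.sum_insert (by simp [*, hab.ne.symm]), Finset.sum_pair (by simp [*])] at this
    rcases hweight with h | ⟨-, h⟩ <;> linarith
  rcases hweight with hweight | ⟨hbd', hweight⟩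
  · have := sum_le_eigenvalue_mul_sub hxpos heig hw (T := {a, c}) (by simp [*])
    rw [Finset.sum_pair (by simp [*])] at this
    linarith
  by_cases hwb : G.Adj w b
  · obtain ⟨-, -, nd⟩ := hfree.not_adj_of_wheel hb ha hc hd hab.symm hbc hbd' hac hcd
      had.ne hwu hwn hwb
    have := sum_le_eigenvalue_mul_sub hxpos heig hw (T := {a, c, d}) (by simp [*])
    rw [Finset.sum_insert (by simp [*]), Finset.sum_pair (by simp [*])] at this
    linarith
  · have := sum_le_eigenvalue_mul_sub hxpos heig hw (T := {a, b, c}) (by simp [*])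
    rw [Finset.sum_insert (by simp [*]), Finset.sum_pair (by simp [*])] at this
    linarith

/-- A connected `P₅`-free graph whose `gamma`-sum is positive for some weights `y ≤ 1` contains
`K₄ - e`, with large total weight. -/
lemma P5Free.exists_diamond_of_weight_pos {α : Type*} [Fintype α] [Nontrivial α]
    {K : SimpleGraph α} (hfree : P5Free K) (hconn : K.Connected) {y : α → ℝ} (hy : ∀ k, y k ≤ 1)
    (hpos : 0 < ∑ k, ((K.degree k : ℝ) - 1) * y k - K.edgeFinset.card) :
    ∃ a b c d, K.Adj a b ∧ K.Adj a c ∧ K.Adj a d ∧ K.Adj b c ∧ K.Adj c d ∧ b ≠ d ∧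
      (5 < 2 * y a + y b + 2 * y c + y d ∨ K.Adj b d ∧ 3 < y a + y b + y c + y d) := by
  have hhand : (∑ k, (K.degree k : ℝ)) = 2 * K.edgeFinset.card := by
    exact_mod_cast K.sum_degrees_eq_twice_card_edges
  have hcard : Fintype.card α < K.edgeFinset.card := by
    have hle : ∑ k, ((K.degree k : ℝ) - 1) * y k ≤ ∑ k, ((K.degree k : ℝ) - 1) := by
      refine Finset.sum_le_sum fun k _ => ?_
      have : (1 : ℝ) ≤ K.degree k := by
        exact_mod_cast hconn.preconnected.degree_pos_of_nontrivial k
      nlinarith [hy k]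
    rw [Finset.sum_sub_distrib, hhand] at hle
    simp only [Finset.sum_const, Finset.card_univ, nsmul_eq_mul, mul_one] at hle
    have : (Fintype.card α : ℝ) < K.edgeFinset.card := by linarith
    exact_mod_cast this
  obtain ⟨a, b, c, d, hab, hbc, hcd, hda, hac, hbd⟩ := hfree.exists_four_cycle hconn hcard
  have hall := hfree.eq_of_four_cycle hconn hab hbc hcd hda hac hbd
  have huniv : (Finset.univ : Finset α) = {a, b, c, d} := by
    ext v
    simpa using hall v
  have h1 := hab.ne
  have h2 := hbc.ne
  have h3 := hcd.ne
  have h4 := hda.ne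
  have hsum : ∀ f : α → ℝ, ∑ k, f k = f a + f b + f c + f d := by
    intro f
    rw [huniv, Finset.sum_insert (by simp; grind), Finset.sum_insert (by simp; grind),
      Finset.sum_pair h3]
    ring
  have hdeg : ∀ k, (K.degree k : ℝ) = (if K.Adj k a then 1 else 0) + (if K.Adj k b then 1 else 0)
      + (if K.Adj k c then 1 else 0) + (if K.Adj k d then 1 else 0) := by
    intro k
    rw [← hsum (fun l => if K.Adj k l then (1 : ℝ) else 0), Finset.sum_boole,
      ← SimpleGraph.card_neighborFinset_eq_degree, SimpleGraph.neighborFinset_eq_filter]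
  have hE : (K.edgeFinset.card : ℝ) = (∑ k, (K.degree k : ℝ)) / 2 := by linarith
  rw [hE] at hpos
  simp only [hsum, hdeg, hab, hbc, hcd, hda, hab.symm, hbc.symm, hcd.symm, hda.symm,
    SimpleGraph.irrefl, if_true, if_false, K.adj_comm c a, K.adj_comm d b] at hpos
  have ya := hy a
  have yb := hy b
  have yc := hy c
  have yd := hy d
  by_cases hac' : K.Adj a c
  · refine ⟨a, b, c, d, hab, hac', hda.symm, hbc, hcd, hbd, ?_⟩
    by_cases hbd' : K.Adj b d <;> simp only [hac', hbd', if_true, if_false] at hpos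
    · exact Or.inr ⟨hbd', by linarith⟩
    · exact Or.inl (by linarith)
  by_cases hbd' : K.Adj b d
  · refine ⟨b, a, d, c, hab.symm, hbd', hbc, hda.symm, hcd.symm, hac, Or.inl ?_⟩
    simp only [hac', hbd', if_true, if_false] at hpos
    linarith
  simp only [hac', hbd', if_false] at hpos
  linarith

theorem stmt_12 
    {V : Type} [Fintype V] [DecidableEq V] (G : SimpleGraph V) [DecidableRel G.Adj]
    (m : ℕ) (hm : 88 ≤ m)
    (hfree : F6Free G)
    (hcard : G.edgeSet.ncard = m)
    (hnoiso : ∀ v : V, ∃ w, G.Adj v w)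
    (hmax : ∀ (n : ℕ) (G' : SimpleGraph (Fin n)), F6Free G' → G'.edgeSet.ncard = m →
      (∀ v, ∃ w, G'.Adj v w) → specRad G' ≤ specRad G)
    (lam : ℝ) (hlam : lam = specRad G)
    (hconn : G.Connected)
    (hlow : (1 + Real.sqrt (4 * (m : ℝ) - 3)) / 2 ≤ lam)
    (x : V → ℝ) (hxpos : ∀ v, 0 < x v)
    (heig : (G.adjMatrix ℝ).mulVec x = lam • x)
    (ustar : V) (hustar : ∀ v, x v ≤ x ustar)
   
    (hex : ∃ C : (G.induce (G.neighborSet ustar)).ConnectedComponent,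
      (∃ a b, a ∈ C.supp ∧ b ∈ C.supp ∧ (G.induce (G.neighborSet ustar)).Adj a b) ∧
        0 < gamma G x ustar (Subtype.val '' C.supp)) :
    ∀ w ∈ (insert ustar (G.neighborSet ustar))ᶜ,
      dS G ((insert ustar (G.neighborSet ustar))ᶜ) w = 0 →
        x w ≤ (2 * lam - 3) / (2 * lam) * x ustar := by
  obtain ⟨C, ⟨p, q, hpC, hqC, hpq⟩, hgamma⟩ := hex
  intro w hw hdw
  have hu0 : 0 < x ustar := hxpos ustar
  have hlam0 : 0 < lam := by
    have := Real.sqrt_nonneg (4 * (m : ℝ) - 3)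
    linarith
  simp only [Set.mem_compl_iff, Set.mem_insert_iff, SimpleGraph.mem_neighborSet, not_or] at hw
  obtain ⟨hwu, hwn⟩ := hw
  have hsub : G.neighborFinset w ⊆ G.neighborFinset ustar := by
    intro v hv
    rw [SimpleGraph.mem_neighborFinset] at hv ⊢
    rw [dS, Set.ncard_eq_zero] at hdw
    by_contra hv'
    refine Set.eq_empty_iff_forall_notMem.1 hdw v ⟨hv, ?_⟩
    rintro (rfl | h)
    · exact hwn hv.symm
    · exact hv' h
  let j : C.toSimpleGraph ↪g G :=
    (SimpleGraph.Embedding.induce C.supp).trans (SimpleGraph.Embedding.induce (G.neighborSet ustar))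
  have hjU : ∀ k, G.Adj ustar (j k) := fun k => k.1.2
  have hrange : Subtype.val '' C.supp = Set.range j := by
    ext v
    constructor
    · rintro ⟨k, hk, rfl⟩
      exact ⟨⟨k, hk⟩, rfl⟩
    · rintro ⟨k, rfl⟩
      exact ⟨k.1, k.2, rfl⟩
  have hP5 : P5Free C.toSimpleGraph := by
    intro p q r s t hnd hpq hqr hrs hst
    exact hfree.no_fan (hnd.map j.injective) (j.map_rel_iff.2 hpq) (j.map_rel_iff.2 hqr)
      (j.map_rel_iff.2 hrs) (j.map_rel_iff.2 hst) (hjU p) (hjU q) (hjU r) (hjU s) (hjU t)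
  have : Nontrivial C := ⟨⟨p, hpC⟩, ⟨q, hqC⟩, fun h => hpq.ne (congrArg Subtype.val h)⟩
  rw [hrange, gamma_range_embedding] at hgamma
  obtain ⟨a, b, c, d, hab, hac, had, hbc, hcd, hbd, hweight⟩ :=
    hP5.exists_diamond_of_weight_pos C.connected_toSimpleGraph
      (y := fun k => x (j k) / x ustar) (fun k => (div_le_one hu0).2 (hustar _)) hgamma
  have hweight' : 5 * x ustar < 2 * x (j a) + x (j b) + 2 * x (j c) + x (j d) ∨
      G.Adj (j b) (j d) ∧ 3 * x ustar < x (j a) + x (j b) + x (j c) + x (j d) := by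
    refine hweight.imp (fun h => ?_) (fun h => ⟨j.map_rel_iff.2 h.1, ?_⟩)
    · field_simp at h
      linarith
    · have h := h.2
      field_simp at h
      linarith
  have hmain := hfree.three_halves_le_of_diamond hxpos heig hustar hsub hwu hwn
    (hjU a) (hjU b) (hjU c) (hjU d) (j.map_rel_iff.2 hab) (j.map_rel_iff.2 hac)
    (j.map_rel_iff.2 had) (j.map_rel_iff.2 hbc) (j.map_rel_iff.2 hcd) (j.injective.ne hbd) hweight'
  rw [div_mul_eq_mul_div, le_div_iff₀ (by positivity)]
  linarith
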